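/- Let n ≥ 1, N ≥ 1, let a, b : Fin n → ℝ with a i ≤ b i for all i, set X = Set.Icc a b and w(X) = max_i (b i − a i). Let f : ℝⁿ → ℝ be continuously differentiable with partial derivatives satisfying |∂f/∂x_i(x) − ∂f/∂x_i(y)| ≤ L·max_j |x j − y j| for all x, y ∈ X and all i. For each multi-index j : Fin n → Fin N let X_j be the corresponding box of the uniform partition, with midpoint c_j, half-widths r_j i = (b i − a i)/(2N), and M_j i = sup_{x ∈ X_j} |∂f/∂x_i(x)|. Define the Subdomain Lower Bound LB_N = min_{j} ( f(c_j) − Σ_i M_j i · r_j i ). Then LB_N is a valid lower bound converging with second order: 0 ≤ inf_{x ∈ X} f(x) − LB_N ≤ n·L·(w(X)/N)². -/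

import Mathlib

/-- Left endpoints of the subbox of the uniform partition of `Set.Icc a b`
with `N` subintervals per dimension, indexed by the multi-index `j`. -/
noncomputable def uniformSubLo (n N : ℕ) (a b : Fin n → ℝ) (j : Fin n → Fin N) : Fin n → ℝ :=
  fun i => a i + ((j i : ℕ) : ℝ) * (b i - a i) / N

/-- Right endpoints of the subbox of the uniform partition of `Set.Icc a b`
with `N` subintervals per dimension, indexed by the multi-index `j`. -/
noncomputable def uniformSubHi (n N : ℕ) (a b : Fin n → ℝ) (j : Fin n → Fin N) : Fin n → ℝ :=
  fun i => a i + (((j i : ℕ) : ℝ) + 1) * (b i - a i) / N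

lemma aux_mvt (n : ℕ) (f : (Fin n → ℝ) → ℝ) (hf : ContDiff ℝ 1 f) (lo hi x y : Fin n → ℝ)
    (hx : x ∈ Set.Icc lo hi) (hy : y ∈ Set.Icc lo hi) :
    ∃ z ∈ Set.Icc lo hi, f y - f x = ∑ i, fderiv ℝ f z (Pi.single i 1) * (y i - x i) := by
  have hd : Differentiable ℝ f := hf.differentiable (by norm_num)
  obtain ⟨z, hz, h⟩ := domain_mvt (s := Set.univ) (f := f) (f' := fun z => fderiv ℝ f z) (x := x) (y := y)
    (fun z _ => (hd z).hasFDerivAt.hasFDerivWithinAt) convex_univ trivial trivial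
  refine ⟨z, (convex_Icc lo hi).segment_subset hx hy hz, ?_⟩
  rw [h]
  have e : y - x = ∑ i, (y i - x i) • (Pi.single i (1:ℝ) : Fin n → ℝ) := by
    have := pi_eq_sum_univ' (y - x)
    ext k
    simp [Finset.sum_apply, Pi.single_apply]
  conv_lhs => rw [e]
  simp only [map_sum, map_smul, smul_eq_mul]
  exact Finset.sum_congr rfl fun i _ => mul_comm _ _

lemma aux_cell (N : ℕ) (hN : 1 ≤ N) (a b x : ℝ) (h1 : a ≤ x) (h2 : x ≤ b) :
    ∃ k : Fin N, a + ((k : ℕ) : ℝ) * (b - a) / N ≤ x ∧ x ≤ a + (((k : ℕ) : ℝ) + 1) * (b - a) / N := by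
  have hN' : (0:ℝ) < N := by exact_mod_cast hN
  rcases (h1.trans h2).eq_or_lt with hab | hab
  · refine ⟨⟨0, hN⟩, ?_, ?_⟩ <;> simp [← hab] <;> linarith
  have hd : 0 < b - a := by linarith
  obtain ⟨t, ht⟩ : ∃ t, t = (x - a) * N / (b - a) := ⟨_, rfl⟩
  have hxt : x = a + t * (b - a) / N := by rw [ht]; field_simp; ring
  have ht0 : 0 ≤ t := by rw [ht]; exact div_nonneg (mul_nonneg (by linarith) hN'.le) hd.le
  have htN : t ≤ N := by
    rw [ht, div_le_iff₀ hd, mul_comm]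
    exact mul_le_mul_of_nonneg_left (by linarith) hN'.le
  have key : ∃ k : Fin N, ((k : ℕ) : ℝ) ≤ t ∧ t ≤ ((k : ℕ) : ℝ) + 1 := by
    by_cases h : ⌊t⌋₊ < N
    · exact ⟨⟨_, h⟩, Nat.floor_le ht0, (Nat.lt_floor_add_one t).le⟩
    · have : (N : ℝ) ≤ t := (Nat.le_floor_iff ht0).1 (not_lt.1 h)
      refine ⟨⟨N - 1, by omega⟩, ?_, ?_⟩ <;> simp [Nat.cast_sub hN] <;> linarith
  obtain ⟨k, hk1, hk2⟩ := key
  refine ⟨k, ?_, ?_⟩ <;> rw [hxt] <;> gcongr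

theorem subdomain_lower_bound_valid_and_second_order
    (n N : ℕ) (hn : 1 ≤ n) (hN : 1 ≤ N) (a b : Fin n → ℝ) (hab : ∀ i, a i ≤ b i)
    (w : ℝ) (hw : w = ⨆ i, (b i - a i))
    (f : (Fin n → ℝ) → ℝ) (hf : ContDiff ℝ 1 f) (L : ℝ)
    (hL : ∀ x ∈ Set.Icc a b, ∀ y ∈ Set.Icc a b, ∀ i,
      |fderiv ℝ f x (Pi.single i 1) - fderiv ℝ f y (Pi.single i 1)| ≤ L * ⨆ j, |x j - y j|)
    (c : (Fin n → Fin N) → Fin n → ℝ)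
    (hc : ∀ j i, c j i = (uniformSubLo n N a b j i + uniformSubHi n N a b j i) / 2)
    (r : Fin n → ℝ) (hr : ∀ i, r i = (b i - a i) / (2 * N))
    (M : (Fin n → Fin N) → Fin n → ℝ)
    (hM : ∀ j i, M j i = sSup ((fun x => |fderiv ℝ f x (Pi.single i 1)|) ''
      Set.Icc (uniformSubLo n N a b j) (uniformSubHi n N a b j)))
    (LB : ℝ) (hLB : LB = ⨅ j, (f (c j) - ∑ i, M j i * r i)) :
    0 ≤ sInf (f '' Set.Icc a b) - LB ∧
    sInf (f '' Set.Icc a b) - LB ≤ (n : ℝ) * L * (w / N) ^ 2 := by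
  have hN' : (0:ℝ) < N := by exact_mod_cast hN
  have hN1 : (1:ℝ) ≤ N := by exact_mod_cast hN
  haveI : Nonempty (Fin n) := ⟨⟨0, hn⟩⟩
  haveI : Nonempty (Fin N) := ⟨⟨0, hN⟩⟩
  have hwi : ∀ i, b i - a i ≤ w := fun i => by
    rw [hw]; exact le_ciSup (f := fun i => b i - a i) (Set.finite_range _).bddAbove i
  have hw0 : 0 ≤ w := by
    have i0 : Fin n := ⟨0, hn⟩
    linarith [hwi i0, hab i0]
  obtain ⟨h, hh⟩ : ∃ h, h = w / N := ⟨_, rfl⟩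
  have hh0 : 0 ≤ h := by rw [hh]; positivity
  have hr0 : ∀ i, 0 ≤ r i := fun i => by
    rw [hr]; exact div_nonneg (by linarith [hab i]) (by positivity)
  have hrh : ∀ i, r i ≤ h / 2 := fun i => by
    rw [hr, hh, div_div, mul_comm (N:ℝ)]
    gcongr
    exact hwi i
  have hlo : ∀ j i, uniformSubLo n N a b j i = c j i - r i := fun j i => by
    rw [hc, hr]; unfold uniformSubLo uniformSubHi; field_simp; ring
  have hhi : ∀ j i, uniformSubHi n N a b j i = c j i + r i := fun j i => by
    rw [hc, hr]; unfold uniformSubLo uniformSubHi; field_simp; ring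
  have hmem : ∀ j x, x ∈ Set.Icc (uniformSubLo n N a b j) (uniformSubHi n N a b j) ↔
      ∀ i, |x i - c j i| ≤ r i := fun j x => by
    simp only [Set.mem_Icc, Pi.le_def, hlo, hhi, abs_le]
    constructor
    · rintro ⟨h1, h2⟩ i
      constructor <;> linarith [h1 i, h2 i]
    · intro h1
      exact ⟨fun i => by linarith [(h1 i).1], fun i => by linarith [(h1 i).2]⟩
  have hsub : ∀ j, Set.Icc (uniformSubLo n N a b j) (uniformSubHi n N a b j) ⊆ Set.Icc a b := by
    intro j
    apply Set.Icc_subset_Icc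
    · intro i
      unfold uniformSubLo
      have : 0 ≤ ((j i : ℕ) : ℝ) * (b i - a i) / N :=
        div_nonneg (mul_nonneg (Nat.cast_nonneg _) (by linarith [hab i])) hN'.le
      linarith
    · intro i
      unfold uniformSubHi
      have h1 : (((j i : ℕ) : ℝ) + 1) ≤ N := by exact_mod_cast (j i).2
      have : (((j i : ℕ) : ℝ) + 1) * (b i - a i) / N ≤ b i - a i := by
        rw [div_le_iff₀ hN', mul_comm]
        exact mul_le_mul_of_nonneg_left h1 (by linarith [hab i])
      linarith
  have hcm : ∀ j, c j ∈ Set.Icc (uniformSubLo n N a b j) (uniformSubHi n N a b j) := fun j => by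
    rw [hmem]; intro i; simpa using hr0 i
  have hg : ∀ i, Continuous fun x => |fderiv ℝ f x (Pi.single i 1)| := fun i =>
    ((hf.continuous_fderiv (by norm_num)).clm_apply continuous_const).abs
  have hMle : ∀ j i, ∀ x ∈ Set.Icc (uniformSubLo n N a b j) (uniformSubHi n N a b j),
      |fderiv ℝ f x (Pi.single i 1)| ≤ M j i := fun j i x hx => by
    rw [hM]
    exact le_csSup (isCompact_Icc.image (hg i)).bddAbove ⟨x, hx, rfl⟩
  have hbdd : BddBelow (f '' Set.Icc a b) := (isCompact_Icc.image hf.continuous).bddBelow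
  have hLw : 0 ≤ L * w := by
    have i0 : Fin n := ⟨0, hn⟩
    have := (abs_nonneg _).trans (hL b ⟨hab, le_rfl⟩ a ⟨le_rfl, hab⟩ i0)
    have e : (⨆ j, |b j - a j|) = w := by
      rw [hw]; congr 1; ext i; exact abs_of_nonneg (by linarith [hab i])
    rwa [e] at this
  have hK0 : 0 ≤ L * (h / 2) := by
    have : L * (h / 2) = L * w / (2 * N) := by rw [hh]; field_simp
    rw [this]; positivity
  have hLip : ∀ j i, ∀ x ∈ Set.Icc (uniformSubLo n N a b j) (uniformSubHi n N a b j),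
      |fderiv ℝ f x (Pi.single i 1) - fderiv ℝ f (c j) (Pi.single i 1)| ≤ L * (h / 2) := by
    intro j i x hx
    refine (hL x (hsub j hx) _ (hsub j (hcm j)) i).trans ?_
    have h1 : (⨆ k, |x k - c j k|) ≤ h / 2 :=
      ciSup_le fun k => ((hmem j x).1 hx k).trans (hrh k)
    have h0 : 0 ≤ ⨆ k, |x k - c j k| := Real.iSup_nonneg fun k => abs_nonneg _
    rcases hw0.eq_or_lt with hw' | hw'
    · have : h = 0 := by rw [hh, ← hw']; simp
      have e : (⨆ k, |x k - c j k|) = 0 := by linarith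
      rw [e, this]; simp
    · exact mul_le_mul_of_nonneg_left h1 (nonneg_of_mul_nonneg_left hLw hw')
  constructor
  · rw [sub_nonneg]
    apply le_csInf ((Set.nonempty_Icc.2 hab).image f)
    rintro _ ⟨x, hx, rfl⟩
    choose j hj1 hj2 using fun i => aux_cell N hN (a i) (b i) (x i) (hx.1 i) (hx.2 i)
    have hxj : x ∈ Set.Icc (uniformSubLo n N a b j) (uniformSubHi n N a b j) := ⟨hj1, hj2⟩
    have h1 : LB ≤ f (c j) - ∑ i, M j i * r i := by
      rw [hLB]
      exact ciInf_le (f := fun j => f (c j) - ∑ i, M j i * r i) (Set.finite_range _).bddBelow j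
    obtain ⟨z, hz, e⟩ := aux_mvt n f hf _ _ _ _ (hcm j) hxj
    have h2 : -∑ i, M j i * r i ≤ ∑ i, fderiv ℝ f z (Pi.single i 1) * (x i - c j i) := by
      rw [← Finset.sum_neg_distrib]
      refine Finset.sum_le_sum fun i _ => ?_
      have h3 : |fderiv ℝ f z (Pi.single i 1) * (x i - c j i)| ≤ M j i * r i := by
        rw [abs_mul]
        exact mul_le_mul (hMle j i z hz) ((hmem j x).1 hxj i) (abs_nonneg _)
          ((abs_nonneg _).trans (hMle j i z hz))
      exact (abs_le.1 h3).1
    linarith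
  · rw [sub_le_iff_le_add, ← sub_le_iff_le_add', hLB]
    refine le_ciInf fun j => ?_
    rw [← hh]
    obtain ⟨x, hxdef⟩ : ∃ x : Fin n → ℝ, ∀ i, x i = c j i -
      (if 0 ≤ fderiv ℝ f (c j) (Pi.single i 1) then r i else - r i) := ⟨_, fun i => rfl⟩
    have hxj : x ∈ Set.Icc (uniformSubLo n N a b j) (uniformSubHi n N a b j) := by
      rw [hmem]; intro i
      rw [hxdef]
      split_ifs <;> simp [abs_of_nonneg (hr0 i)]
    obtain ⟨z, hz, e⟩ := aux_mvt n f hf _ _ _ _ (hcm j) hxj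
    have hinf : sInf (f '' Set.Icc a b) ≤ f x := csInf_le hbdd ⟨x, hsub j hxj, rfl⟩
    have h2 : ∑ i, fderiv ℝ f z (Pi.single i 1) * (x i - c j i) ≤
        ∑ i, (L * h * (h / 2) - M j i * r i) := by
      refine Finset.sum_le_sum fun i _ => ?_
      have hMi : M j i ≤ |fderiv ℝ f (c j) (Pi.single i 1)| + L * (h / 2) := by
        rw [hM]
        apply csSup_le (Set.Nonempty.image _ ⟨_, hcm j⟩)
        rintro _ ⟨y, hy, rfl⟩
        have := hLip j i y hy
        have := abs_sub_abs_le_abs_sub (fderiv ℝ f y (Pi.single i 1))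
          (fderiv ℝ f (c j) (Pi.single i 1))
        dsimp only
        linarith
      have hz' := abs_le.1 (hLip j i z hz)
      have h3 : fderiv ℝ f z (Pi.single i 1) * (x i - c j i) ≤
          (L * (h / 2) - |fderiv ℝ f (c j) (Pi.single i 1)|) * r i := by
        rw [hxdef]
        split_ifs with hs
        · rw [abs_of_nonneg hs]
          nlinarith [hr0 i, mul_nonneg (hr0 i) (by linarith [hz'.1] :
            0 ≤ L * (h / 2) + (fderiv ℝ f z (Pi.single i 1) - fderiv ℝ f (c j) (Pi.single i 1)))]
        · rw [abs_of_neg (not_le.1 hs)]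
          nlinarith [hr0 i, mul_nonneg (hr0 i) (by linarith [hz'.2] :
            0 ≤ L * (h / 2) - (fderiv ℝ f z (Pi.single i 1) - fderiv ℝ f (c j) (Pi.single i 1)))]
      have h4 := mul_le_mul_of_nonneg_right hMi (hr0 i)
      have h5 := mul_le_mul_of_nonneg_left (hrh i) hK0
      linarith
    rw [Finset.sum_sub_distrib, Finset.sum_const, Finset.card_univ, Fintype.card_fin,
      nsmul_eq_mul] at h2
    have h6 : 0 ≤ (n:ℝ) * (L * (h / 2) * h) :=
      mul_nonneg (Nat.cast_nonneg _) (mul_nonneg hK0 hh0)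
    linarith
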